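/- Let G = (V₁,E₁) be a connected graph with |V₁| ≥ 2, and for integers p ≥ 1 and q ≥ 1 let pK_q denote the disjoint union of p copies of the complete graph K_q. Writing Q = QEC(G), one has QEC(G ⊙ pK_q) = (1/2)·[ (pq+1)Q − (q+1) + √( ((pq+1)Q − (q+1))² + 4(q+1)Q ) ]. -/

import Mathlib

open scoped BigOperators
open Filter Topology
open scoped Classical

namespace QECPaper

/-- The cone (join) `K₁ + H` over a graph `H`: vertex `none` is the apex. -/
def cone {V₂ : Type*} (H : SimpleGraph V₂) : SimpleGraph (Option V₂) where
  Adj x y := (∃ a b, x = some a ∧ y = some b ∧ H.Adj a b) ∨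
    (x = none ∧ y ≠ none) ∨ (x ≠ none ∧ y = none)
  symm := by
    constructor
    rintro x y (⟨a, b, rfl, rfl, h⟩ | ⟨rfl, hy⟩ | ⟨hx, rfl⟩)
    · exact Or.inl ⟨b, a, rfl, rfl, h.symm⟩
    · exact Or.inr (Or.inr ⟨hy, rfl⟩)
    · exact Or.inr (Or.inl ⟨rfl, hx⟩)
  loopless := by
    constructor
    rintro x (⟨a, b, rfl, hb, h⟩ | ⟨rfl, hy⟩ | ⟨hx, rfl⟩)
    · exact H.loopless.irrefl a (by cases hb; exact h)
    · exact hy rfl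
    · exact hx rfl

/-- The corona `G ⊙ H` of two graphs, realized on `V₁ × ({o} ∪ V₂)`
with `o = none`. -/
def corona {V₁ V₂ : Type*} (G : SimpleGraph V₁) (H : SimpleGraph V₂) :
    SimpleGraph (V₁ × Option V₂) where
  Adj p q := (p.1 = q.1 ∧ (cone H).Adj p.2 q.2) ∨
    (G.Adj p.1 q.1 ∧ p.2 = none ∧ q.2 = none)
  symm := by
    constructor
    rintro ⟨i, x⟩ ⟨j, y⟩ (⟨h1, h2⟩ | ⟨h1, h2, h3⟩)
    · exact Or.inl ⟨h1.symm, (cone H).symm.symm _ _ h2⟩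
    · exact Or.inr ⟨h1.symm, h3, h2⟩
  loopless := by
    constructor
    rintro ⟨i, x⟩ (⟨h1, h2⟩ | ⟨h1, h2, h3⟩)
    · exact (cone H).loopless.irrefl x h2
    · exact G.loopless.irrefl i h1

/-- The quadratic embedding constant of a (connected) graph on a finite vertex set. -/
noncomputable def QEC {V : Type*} [Fintype V] (G : SimpleGraph V) : ℝ :=
  sSup {r : ℝ | ∃ f : V → ℝ, (∑ x, f x ^ 2) = 1 ∧ (∑ x, f x) = 0 ∧
    r = ∑ x, ∑ y, f x * (G.dist x y : ℝ) * f y}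

/-- The set `λ(S)` of `λ` appearing in a solution of the basic equations. -/
def lambdaS {V : Type*} [Fintype V] (G : SimpleGraph V) : Set ℝ :=
  {lam : ℝ | ∃ (f : V → ℝ) (μ : ℝ),
    (∀ x, (∑ y, (G.dist x y : ℝ) * f y) - lam * f x = μ / 2) ∧
    (∑ x, f x) = 0 ∧ (∑ x, f x ^ 2) = 1}

/-- The distance matrix of a graph, with real entries. -/
noncomputable def distMatrix {V : Type*} (G : SimpleGraph V) : Matrix V V ℝ :=
  Matrix.of fun x y => (G.dist x y : ℝ)

section MatrixFunctions

variable {ι : Type*} [Fintype ι] [DecidableEq ι]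

/-- The eigenspace `ker (A - α)` inside `EuclideanSpace ℝ ι`. -/
noncomputable def eigSpace (A : Matrix ι ι ℝ) (α : ℝ) :
    Submodule ℝ (EuclideanSpace ℝ ι) :=
  LinearMap.ker (Matrix.toEuclideanLin A - α • LinearMap.id)

/-- The all-ones vector of `EuclideanSpace ℝ ι`. -/
noncomputable def onesE (ι : Type*) [Fintype ι] : EuclideanSpace ℝ ι :=
  (WithLp.equiv 2 (ι → ℝ)).symm (fun _ => 1)

/-- `‖E_α 𝟏‖²`, where `E_α` is the orthogonal projection of `EuclideanSpace ℝ ι`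
onto the eigenspace `ker (A - α)`. -/
noncomputable def projNormSq (A : Matrix ι ι ℝ) (α : ℝ) : ℝ :=
  ‖(Submodule.orthogonalProjectionOnto (eigSpace A α) (onesE ι) : EuclideanSpace ℝ ι)‖ ^ 2

/-- The set of (real) eigenvalues of a matrix. -/
def evSet (A : Matrix ι ι ℝ) : Set ℝ :=
  {α : ℝ | ∃ v : ι → ℝ, v ≠ 0 ∧ A.mulVec v = α • v}

/-- The set of main eigenvalues: those `α` with `E_α 𝟏 ≠ 0`. -/
def mainEv (A : Matrix ι ι ℝ) : Set ℝ := {α : ℝ | projNormSq A α ≠ 0}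

/-- `k_A = |ev_M(A) \ {-2}|`. -/
noncomputable def kA (A : Matrix ι ι ℝ) : ℕ := (mainEv A \ {(-2 : ℝ)}).ncard

/-- The ω-function associated with the symmetric matrix `A`. -/
noncomputable def omegaFun (A : Matrix ι ι ℝ) (lam : ℝ) : ℝ :=
  1 + projNormSq A (-2) +
    ∑ᶠ α ∈ mainEv A \ {(-2 : ℝ)}, lam / (α + 2 + lam) * projNormSq A α

/-- The (maximal) domain of the ω-function: the complement of its poles. -/
def omegaDomain (A : Matrix ι ι ℝ) : Set ℝ :=
  {lam : ℝ | ∀ α ∈ mainEv A \ {(-2 : ℝ)}, lam ≠ -α - 2}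

/-- The set of zeroes of the ω-function (on its domain). -/
def omegaZeros (A : Matrix ι ι ℝ) : Set ℝ :=
  {lam : ℝ | lam ∈ omegaDomain A ∧ omegaFun A lam = 0}

/-- `λ*`, the largest zero of the ω-function. -/
noncomputable def lamStar (A : Matrix ι ι ℝ) : ℝ := sSup (omegaZeros A)

/-- The ψ-function associated with `A`: `ψ_A(λ) = λ/ω_A(λ)` extended
analytically across the poles of `ω_A` by the value `0`. -/
noncomputable def psiFun (A : Matrix ι ι ℝ) (lam : ℝ) : ℝ :=
  if -lam - 2 ∈ mainEv A \ {(-2 : ℝ)} then 0 else lam / omegaFun A lam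

/-- The inverse of the rightmost branch `ψ_{A*} = ψ_A ↾ (λ*, +∞)`:
`ψ_{A*}⁻¹(y)` is the unique `λ > λ*` with `ψ_A(λ) = y`. -/
noncomputable def psiStarInv (A : Matrix ι ι ℝ) (y : ℝ) : ℝ :=
  sSup {lam : ℝ | lamStar A < lam ∧ psiFun A lam = y}

end MatrixFunctions


/-- A function that vanishes at `v` and decreases by at most one along each edge is a lower
bound for the distance to `v`. -/
lemma le_dist_of_adj_le {V : Type*} {G : SimpleGraph V} (hG : G.Connected) {v : V} (r : V → ℕ)
    (hv : r v = 0) (hr : ∀ u w, G.Adj u w → r u ≤ r w + 1) (u : V) : r u ≤ G.dist u v := by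
  obtain ⟨w, hw⟩ := hG.exists_walk_length_eq_dist u v
  rw [← hw]
  clear hw
  induction w with
  | nil => simp [hv]
  | cons h w ih =>
    have := hr _ _ h
    have := ih hv
    simp only [SimpleGraph.Walk.length_cons]
    omega

section CoronaDistance

variable {V₁ V₂ : Type*} (G : SimpleGraph V₁) (H : SimpleGraph V₂)

/-- The distance from the apex in a cone. -/
def apexDist : Option V₂ → ℕ
  | none => 0
  | some _ => 1

/-- The defect `d(o, x) + d(o, y) - d(x, y)` in the cone over `H`. -/
noncomputable def coneDefect : Option V₂ → Option V₂ → ℕ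
  | some a, some b => if a = b then 2 else if H.Adj a b then 1 else 0
  | _, _ => 0

lemma coneDefect_le (x y : Option V₂) : coneDefect H x y ≤ apexDist x + apexDist y := by
  rcases x with _ | a <;> rcases y with _ | b <;> simp only [coneDefect, apexDist] <;>
    (try split_ifs) <;> omega

lemma corona_adj_none_some (i : V₁) (a : V₂) : (corona G H).Adj (i, none) (i, some a) :=
  Or.inl ⟨rfl, Or.inr (Or.inl ⟨rfl, by simp⟩)⟩

/-- The embedding of `G` into the corona as the graph of apexes. -/
def coronaBase : G →g corona G H where
  toFun i := (i, none)
  map_rel' h := Or.inr ⟨h, rfl, rfl⟩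

lemma exists_walk_apex (i : V₁) (x : Option V₂) :
    ∃ w : (corona G H).Walk (i, x) (i, none), w.length = apexDist x := by
  rcases x with _ | a
  · exact ⟨.nil, rfl⟩
  · exact ⟨.cons (corona_adj_none_some G H i a).symm .nil, rfl⟩

lemma exists_walk_corona (hG : G.Connected) (i j : V₁) (x y : Option V₂) :
    ∃ w : (corona G H).Walk (i, x) (j, y),
      w.length = G.dist i j + apexDist x + apexDist y := by
  obtain ⟨w₁, h₁⟩ := exists_walk_apex G H i x
  obtain ⟨w₂, h₂⟩ := exists_walk_apex G H j y
  obtain ⟨w, h⟩ := hG.exists_walk_length_eq_dist i j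
  obtain ⟨w', h'⟩ : ∃ w' : (corona G H).Walk (i, none) (j, none), w'.length = G.dist i j :=
    ⟨w.map (coronaBase G H), (SimpleGraph.Walk.length_map _ _).trans h⟩
  refine ⟨w₁.append (w'.append w₂.reverse), ?_⟩
  rw [SimpleGraph.Walk.length_append, SimpleGraph.Walk.length_append,
    SimpleGraph.Walk.length_reverse, h₁, h₂, h']
  omega

lemma corona_connected (hG : G.Connected) : (corona G H).Connected := by
  have := hG.nonempty
  refine ⟨fun u v => ?_⟩
  exact (exists_walk_corona G H hG u.1 v.1 u.2 v.2).choose.reachable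

/-- The distance in the corona. -/
lemma corona_dist_add (hG : G.Connected) (i j : V₁) (x y : Option V₂) :
    (corona G H).dist (i, x) (j, y) + (if i = j then coneDefect H x y else 0) =
      G.dist i j + apexDist x + apexDist y := by
  have hdef : (if i = j then coneDefect H x y else 0) ≤ apexDist x + apexDist y := by
    split_ifs
    · exact coneDefect_le H x y
    · omega
  apply le_antisymm
  · obtain ⟨w, hw⟩ := exists_walk_corona G H hG i j x y
    have hle := SimpleGraph.dist_le w
    split_ifs with hij
    · subst hij
      rcases x with _ | a
      · simp only [coneDefect]; omega
      rcases y with _ | b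
      · simp only [coneDefect]; omega
      simp only [coneDefect, apexDist, SimpleGraph.dist_self] at *
      split_ifs with hab hadj
      · subst hab; simp
      · have : (corona G H).Adj (i, some a) (i, some b) :=
          Or.inl ⟨rfl, Or.inl ⟨a, b, rfl, rfl, hadj⟩⟩
        rw [SimpleGraph.dist_eq_one_iff_adj.2 this]
      · omega
    · omega
  · have key := le_dist_of_adj_le (corona_connected G H hG) (v := (j, y))
      (fun u => G.dist u.1 j + apexDist u.2 + apexDist y -
        (if u.1 = j then coneDefect H u.2 y else 0)) ?_ ?_ (i, x)
    · simp only at key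
      omega
    · rcases y with _ | b <;> simp [coneDefect, apexDist]
    · rintro ⟨k, z⟩ ⟨l, t⟩ (⟨rfl, h⟩ | ⟨h, rfl, rfl⟩)
      · rcases h with ⟨a, b, rfl, rfl, h⟩ | ⟨rfl, h⟩ | ⟨h, rfl⟩
        · have hne := h.ne
          rcases y with _ | c <;> simp only [coneDefect, apexDist]
          · omega
          · have := h.symm
            split_ifs <;> first | omega | grind
        · obtain ⟨b, rfl⟩ := Option.ne_none_iff_exists'.1 h
          rcases y with _ | c <;> simp only [coneDefect, apexDist] <;> split_ifs <;> omega
        · obtain ⟨b, rfl⟩ := Option.ne_none_iff_exists'.1 h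
          rcases y with _ | c <;> simp only [coneDefect, apexDist] <;> split_ifs <;> omega
      · have h1 : G.dist k j ≤ G.dist l j + 1 := by
          have := hG.dist_triangle (u := k) (v := l) (w := j)
          rw [SimpleGraph.dist_eq_one_iff_adj.2 h] at this
          omega
        have hz : ∀ y : Option V₂, coneDefect H none y = 0 := fun y => by cases y <;> rfl
        simp only [hz, ite_self]
        omega

end CoronaDistance

section QuadraticForm

variable {V : Type*} [Fintype V] (G : SimpleGraph V)

/-- The quadratic form `⟨f, D f⟩` of the distance matrix. -/
noncomputable def distForm (f : V → ℝ) : ℝ := ∑ x, ∑ y, f x * (G.dist x y : ℝ) * f y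

lemma distForm_smul (c : ℝ) (f : V → ℝ) :
    distForm G (fun x => c * f x) = c ^ 2 * distForm G f := by
  simp only [distForm, Finset.mul_sum]
  exact Finset.sum_congr rfl fun x _ => Finset.sum_congr rfl fun y _ => by ring

lemma bddAbove_distForm :
    BddAbove {r : ℝ | ∃ f : V → ℝ, (∑ x, f x ^ 2) = 1 ∧ (∑ x, f x) = 0 ∧
      r = ∑ x, ∑ y, f x * (G.dist x y : ℝ) * f y} := by
  refine ⟨∑ x, ∑ y, (G.dist x y : ℝ), ?_⟩
  rintro r ⟨f, h1, -, rfl⟩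
  have hf : ∀ x, f x ^ 2 ≤ 1 := fun x => h1 ▸
    Finset.single_le_sum (f := fun x => f x ^ 2) (fun y _ => sq_nonneg (f y)) (Finset.mem_univ x)
  refine Finset.sum_le_sum fun x _ => Finset.sum_le_sum fun y _ => ?_
  have hxy : f x * f y ≤ 1 := by nlinarith [hf x, hf y, sq_nonneg (f x - f y)]
  have hd : (0 : ℝ) ≤ G.dist x y := Nat.cast_nonneg _
  nlinarith

lemma distForm_le_QEC (f : V → ℝ) (hf : ∑ x, f x = 0) :
    distForm G f ≤ QEC G * ∑ x, f x ^ 2 := by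
  have hN : 0 ≤ ∑ x, f x ^ 2 := Finset.sum_nonneg fun x _ => sq_nonneg (f x)
  rcases hN.eq_or_lt with h0 | hpos
  · have hz : ∀ x, f x = 0 := fun x => by
      have := (Finset.sum_eq_zero_iff_of_nonneg fun x _ => sq_nonneg (f x)).1 h0.symm x
        (Finset.mem_univ x)
      exact pow_eq_zero_iff two_ne_zero |>.1 this
    simp [distForm, hz]
  · set N := ∑ x, f x ^ 2 with hNdef
    have hs : (Real.sqrt N)⁻¹ ^ 2 = N⁻¹ := by rw [inv_pow, Real.sq_sqrt hN]
    have hmem : distForm G (fun x => (Real.sqrt N)⁻¹ * f x) ≤ QEC G := by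
      refine le_csSup (bddAbove_distForm G) ⟨_, ?_, ?_, rfl⟩
      · simp only [mul_pow, ← Finset.mul_sum, hs, ← hNdef]
        exact inv_mul_cancel₀ hpos.ne'
      · rw [← Finset.mul_sum, hf, mul_zero]
    rw [distForm_smul, hs, inv_mul_le_iff₀ hpos] at hmem
    linarith

lemma distForm_dipole {x y : V} (hxy : x ≠ y) :
    (∑ z, (Pi.single x (1 : ℝ) - Pi.single y 1 : V → ℝ) z = 0) ∧
    (∑ z, (Pi.single x (1 : ℝ) - Pi.single y 1 : V → ℝ) z ^ 2 = 2) ∧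
    distForm G (Pi.single x (1 : ℝ) - Pi.single y 1) = - 2 * G.dist x y := by
  refine ⟨by simp [Finset.sum_sub_distrib], ?_, ?_⟩
  · have : ∀ z, (Pi.single x (1 : ℝ) - Pi.single y 1 : V → ℝ) z ^ 2 =
        (Pi.single x (1 : ℝ) : V → ℝ) z + (Pi.single y (1 : ℝ) : V → ℝ) z := by
      intro z
      by_cases h1 : z = x
      · subst h1; simp [hxy]
      · by_cases h2 : z = y
        · subst h2; simp [h1]
        · simp [h1, h2]
    simp only [this, Finset.sum_add_distrib]
    simp; norm_num
  · simp [distForm, Pi.single_apply, sub_mul, mul_sub, Finset.sum_sub_distrib,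
      SimpleGraph.dist_comm (u := y) (v := x)]
    ring

lemma QEC_le [Nontrivial V] {c : ℝ}
    (h : ∀ f : V → ℝ, ∑ x, f x = 0 → distForm G f ≤ c * ∑ x, f x ^ 2) : QEC G ≤ c := by
  refine csSup_le ?_ ?_
  · obtain ⟨x, y, hxy⟩ := exists_pair_ne V
    obtain ⟨h1, h2, -⟩ := distForm_dipole G hxy
    refine ⟨_, fun z => (Real.sqrt 2)⁻¹ * (Pi.single x (1 : ℝ) - Pi.single y 1 : V → ℝ) z,
      ?_, ?_, rfl⟩
    · simp only [mul_pow, ← Finset.mul_sum, h2]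
      norm_num
    · rw [← Finset.mul_sum, h1, mul_zero]
  · rintro r ⟨f, h1, h2, rfl⟩
    simpa [h1, distForm] using h f h2

lemma neg_one_le_QEC [Nontrivial V] (hG : G.Connected) : -1 ≤ QEC G := by
  obtain ⟨x⟩ := hG.nonempty
  obtain ⟨y, hxy⟩ := hG.preconnected.exists_adj_of_nontrivial x
  obtain ⟨h1, h2, h3⟩ := distForm_dipole G hxy.ne
  have := distForm_le_QEC G _ h1
  rw [h2, h3, SimpleGraph.dist_eq_one_iff_adj.2 hxy] at this
  push_cast at this
  linarith

end QuadraticForm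

section CoronaForm

variable {V₁ V₂ : Type*} [Fintype V₁] [Fintype V₂] (G : SimpleGraph V₁) (H : SimpleGraph V₂)

lemma distForm_corona (hG : G.Connected) (f : V₁ × Option V₂ → ℝ) (hf : ∑ u, f u = 0) :
    distForm (corona G H) f = distForm G (fun i => ∑ x, f (i, x)) -
      ∑ i, ∑ a, ∑ b, f (i, some a) * (coneDefect H (some a) (some b) : ℝ) * f (i, some b) := by
  have hd : ∀ u v : V₁ × Option V₂, f u * ((corona G H).dist u v : ℝ) * f v =
      f u * (G.dist u.1 v.1 : ℝ) * f v + (f u * apexDist u.2) * f v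
        + f u * (f v * apexDist v.2)
        - (if u.1 = v.1 then f u * (coneDefect H u.2 v.2 : ℝ) * f v else 0) := by
    rintro ⟨i, x⟩ ⟨j, y⟩
    have h := congrArg (Nat.cast : ℕ → ℝ) (corona_dist_add G H hG i j x y)
    push_cast at h
    rw [← eq_sub_iff_add_eq] at h
    rw [h]
    split_ifs <;> ring
  have hbase : ∑ u, ∑ v, f u * (G.dist u.1 v.1 : ℝ) * f v =
      distForm G (fun i => ∑ x, f (i, x)) := by
    simp only [distForm, Fintype.sum_prod_type, Finset.sum_mul, Finset.mul_sum]
    refine Finset.sum_congr rfl fun i _ => ?_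
    rw [Finset.sum_comm]
    exact Finset.sum_congr rfl fun j _ => Finset.sum_comm
  have hfiber : ∑ u : V₁ × Option V₂, ∑ v : V₁ × Option V₂,
      (if u.1 = v.1 then f u * (coneDefect H u.2 v.2 : ℝ) * f v else 0) =
      ∑ i, ∑ a, ∑ b, f (i, some a) * (coneDefect H (some a) (some b) : ℝ) * f (i, some b) := by
    simp only [Fintype.sum_prod_type]
    refine Finset.sum_congr rfl fun i _ => ?_
    have hz : ∀ x : Option V₂, coneDefect H x none = 0 := fun x => by cases x <;> rfl
    have hz' : ∀ x : Option V₂, coneDefect H none x = 0 := fun x => by cases x <;> rfl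
    have hi : ∀ x : Option V₂, (∑ j, ∑ y : Option V₂,
        if i = j then f (i, x) * (coneDefect H x y : ℝ) * f (j, y) else 0) =
        ∑ b, f (i, x) * (coneDefect H x (some b) : ℝ) * f (i, some b) := by
      intro x
      rw [Finset.sum_eq_single i (fun j _ hj => by simp [hj.symm]) (by simp)]
      simp [Fintype.sum_option, hz]
    simp only [hi]
    simp only [Fintype.sum_option, hz']
    simp
  have hcross : ∑ u, ∑ v, (f u * (apexDist u.2 : ℝ)) * f v = 0 := by
    simp [← Finset.mul_sum, hf]
  have hcross' : ∑ u, ∑ v, f u * (f v * (apexDist v.2 : ℝ)) = 0 := by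
    rw [← Finset.sum_mul_sum, hf, zero_mul]
  simp only [distForm, hd, Finset.sum_sub_distrib, Finset.sum_add_distrib, hcross, hcross', hfiber]
  rw [hbase, distForm]
  ring

end CoronaForm

section DisjointCliques

lemma sum_coneDefect_cliques {ι κ : Type*} [Fintype ι] [Fintype κ] (h : ι × κ → ℝ) :
    ∑ a, ∑ b, h a * (coneDefect (SimpleGraph.fromRel (fun a b : ι × κ => a.1 = b.1))
      (some a) (some b) : ℝ) * h b = ∑ k, (∑ l, h (k, l)) ^ 2 + ∑ a, h a ^ 2 := by
  have hc : ∀ a b : ι × κ, h a * (coneDefect (SimpleGraph.fromRel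
      (fun a b : ι × κ => a.1 = b.1)) (some a) (some b) : ℝ) * h b =
      (if a.1 = b.1 then h a * h b else 0) + (if a = b then h a * h b else 0) := by
    intro a b
    simp only [coneDefect, SimpleGraph.fromRel_adj]
    by_cases hab : a = b
    · subst hab; simp; ring
    · by_cases h1 : a.1 = b.1
      · simp [hab, h1]
      · simp [hab, h1, Ne.symm h1]
  simp only [hc, Finset.sum_add_distrib]
  congr 1
  · simp only [Fintype.sum_prod_type]
    refine Finset.sum_congr rfl fun k _ => ?_
    rw [sq, Finset.sum_mul_sum]
    refine Finset.sum_congr rfl fun l _ => ?_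
    rw [Finset.sum_eq_single k (fun j _ hj => by simp [hj.symm]) (by simp)]
    simp
  · simp [sq]

lemma sq_sum_le_cliques (p q : ℕ) (h : Fin p × Fin q → ℝ) :
    (∑ a, h a) ^ 2 ≤ p * ∑ k, (∑ l, h (k, l)) ^ 2 ∧
      (∑ a, h a) ^ 2 ≤ (p * q : ℝ) * ∑ a, h a ^ 2 := by
  constructor
  · rw [Fintype.sum_prod_type]
    simpa using sq_sum_le_card_mul_sum_sq (s := Finset.univ) (f := fun k => ∑ l, h (k, l))
  · simpa using sq_sum_le_card_mul_sum_sq (s := Finset.univ) (f := h)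

end DisjointCliques

section LargerRoot

/-- Properties of the larger root of `x² - ((n+1)Q - m) x - mQ`. -/
lemma larger_root_spec {n m Q L : ℝ} (hn : 0 < n) (hm : 0 < m)
    (hL : L = ((n + 1) * Q - m + Real.sqrt (((n + 1) * Q - m) ^ 2 + 4 * m * Q)) / 2) :
    (L - Q) * (m + L - n * Q) = n * Q ^ 2 ∧ Q ≤ L ∧ 0 < m + L - n * Q := by
  set b := (n + 1) * Q - m with hb
  have hdisc : b ^ 2 + 4 * m * Q = (b - 2 * Q) ^ 2 + 4 * n * Q ^ 2 := by rw [hb]; ring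
  have hnQ : 0 ≤ n * Q ^ 2 := by positivity
  have hD : 0 ≤ b ^ 2 + 4 * m * Q := by rw [hdisc]; positivity
  have hs := Real.sq_sqrt hD
  have habs : |b - 2 * Q| ≤ Real.sqrt (b ^ 2 + 4 * m * Q) :=
    Real.abs_le_sqrt (by rw [hdisc]; linarith)
  have hl := abs_le.1 habs
  have hprod : (L - Q) * (m + L - n * Q) = n * Q ^ 2 := by
    have : m + L - n * Q = L - b + Q := by rw [hb]; ring
    rw [this, hL]
    nlinarith
  have hQL : Q ≤ L := by rw [hL]; linarith [hl.1]
  have hB : 0 ≤ m + L - n * Q := by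
    have : m + L - n * Q = L - b + Q := by rw [hb]; ring
    rw [this, hL]; linarith [hl.2]
  refine ⟨hprod, hQL, hB.lt_of_ne fun h0 => ?_⟩
  rw [← h0, mul_zero] at hprod
  have hQ : Q = 0 := by
    have := (mul_eq_zero.1 hprod.symm).resolve_left hn.ne'
    exact pow_eq_zero_iff two_ne_zero |>.1 this
  subst hQ
  linarith

lemma clique_fiber_bound {p q Q L s t c e : ℝ} (hp : 0 < p) (hq : 0 < q)
    (hprod : (L - Q) * (q + 1 + L - p * q * Q) = p * q * Q ^ 2)
    (hB : 0 < q + 1 + L - p * q * Q) (hL : -1 ≤ L) (hc : t ^ 2 ≤ p * c)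
    (he : t ^ 2 ≤ p * q * e) : Q * (s + t) ^ 2 ≤ L * (s ^ 2 + e) + (c + e) := by
  have hn : 0 < p * q := by positivity
  have hpsd : p * q * Q * (s + t) ^ 2 ≤ p * q * L * s ^ 2 + (q + 1 + L) * t ^ 2 := by
    have hsq : 0 ≤ (p * q * Q * s - (q + 1 + L - p * q * Q) * t) ^ 2 := sq_nonneg _
    have hexp : (q + 1 + L - p * q * Q) *
        (p * q * L * s ^ 2 + (q + 1 + L) * t ^ 2 - p * q * Q * (s + t) ^ 2) =
        (p * q * Q * s - (q + 1 + L - p * q * Q) * t) ^ 2 := by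
      linear_combination p * q * s ^ 2 * hprod
    rw [← hexp] at hsq
    linarith [nonneg_of_mul_nonneg_right hsq hB]
  have h1 := mul_le_mul_of_nonneg_left hc hq.le
  have h2 := mul_le_mul_of_nonneg_left he (by linarith : 0 ≤ 1 + L)
  refine le_of_mul_le_mul_left ?_ hn
  linarith

end LargerRoot

/-- `QEC(G ⊙ pK_q)` for the disjoint union `pK_q` of `p` copies of
the complete graph `K_q`, realized on `Fin p × Fin q`. -/
theorem qec_corona_pKq {V₁ : Type*} [Fintype V₁] (G : SimpleGraph V₁)
    (hG : G.Connected) (hV₁ : 2 ≤ Fintype.card V₁)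
    (p q : ℕ) (hp : 1 ≤ p) (hq : 1 ≤ q) :
    QEC (corona G (SimpleGraph.fromRel (fun a b : Fin p × Fin q => a.1 = b.1))) =
      (((p : ℝ) * q + 1) * QEC G - ((q : ℝ) + 1) +
        Real.sqrt ((((p : ℝ) * q + 1) * QEC G - ((q : ℝ) + 1)) ^ 2 +
          4 * ((q : ℝ) + 1) * QEC G)) / 2 := by
  have : Nontrivial V₁ := Fintype.one_lt_card_iff_nontrivial.1 hV₁
  have hp0 : (0 : ℝ) < p := by exact_mod_cast hp
  have hq0 : (0 : ℝ) < q := by exact_mod_cast hq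
  set H := SimpleGraph.fromRel (fun a b : Fin p × Fin q => a.1 = b.1)
  set Q := QEC G with hQ
  have hn : (0 : ℝ) < p * q := by positivity
  obtain ⟨L, hL⟩ : ∃ L, L = (((p : ℝ) * q + 1) * Q - ((q : ℝ) + 1) +
        Real.sqrt ((((p : ℝ) * q + 1) * Q - ((q : ℝ) + 1)) ^ 2 +
          4 * ((q : ℝ) + 1) * Q)) / 2 := ⟨_, rfl⟩
  rw [← hL]
  obtain ⟨hprod, hQL, hB⟩ := larger_root_spec hn (by positivity : (0 : ℝ) < (q : ℝ) + 1) hL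
  have hQ1 : -1 ≤ Q := neg_one_le_QEC G hG
  have hform : ∀ f : V₁ × Option (Fin p × Fin q) → ℝ, ∑ u, f u = 0 →
      distForm (corona G H) f = distForm G (fun i => ∑ x, f (i, x)) -
        ∑ i, (∑ k, (∑ l, f (i, some (k, l))) ^ 2 + ∑ a, f (i, some a) ^ 2) := by
    intro f hf
    rw [distForm_corona G H hG f hf]
    congr 1
    exact Finset.sum_congr rfl fun i _ => sum_coneDefect_cliques fun a => f (i, some a)
  apply le_antisymm
  · refine QEC_le _ fun f hf => ?_
    have hg := distForm_le_QEC G (fun i => ∑ x, f (i, x))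
      (by rw [← Fintype.sum_prod_type]; exact hf)
    rw [hform f hf, sub_le_iff_le_add]
    refine hg.trans ?_
    rw [Fintype.sum_prod_type, Finset.mul_sum, Finset.mul_sum, ← Finset.sum_add_distrib]
    refine Finset.sum_le_sum fun i _ => ?_
    obtain ⟨h1, h2⟩ := sq_sum_le_cliques p q fun a => f (i, some a)
    simp only [Fintype.sum_option]
    rw [← hQ]
    generalize f (i, none) = s at *
    generalize ∑ a, f (i, some a) = t at *
    generalize ∑ k, (∑ l, f (i, some (k, l))) ^ 2 = c at *
    generalize ∑ a, f (i, some a) ^ 2 = e at *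
    exact clique_fiber_bound hp0 hq0 hprod hB (hQ1.trans hQL) h1 h2
  · obtain ⟨M, hM⟩ : ∃ M, M = QEC (corona G H) := ⟨_, rfl⟩
    rw [← hM]
    obtain ⟨B, hBdef⟩ : ∃ B, B = (q : ℝ) + 1 + L - p * q * Q := ⟨_, rfl⟩
    rw [← hBdef] at hB hprod
    have hT : 0 < (B + p * q * Q) ^ 2 := by
      have : 0 < B + p * q * Q := by rw [hBdef]; linarith
      positivity
    have hN : 0 < B ^ 2 + p * q * Q ^ 2 := by positivity
    have hQle : Q ≤ (M * (B ^ 2 + p * q * Q ^ 2) + p * q * (q + 1) * Q ^ 2) /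
        (B + p * q * Q) ^ 2 := by
      refine QEC_le G fun g hg => ?_
      let f : V₁ × Option (Fin p × Fin q) → ℝ := fun u => (u.2.elim B fun _ => Q) * g u.1
      have hfib : ∀ i, ∑ x, f (i, x) = (B + p * q * Q) * g i := by
        intro i
        simp [f, Fintype.sum_option]
        ring
      have hf : ∑ u, f u = 0 := by
        rw [Fintype.sum_prod_type]
        simp only [hfib, ← Finset.mul_sum, hg, mul_zero]
      have h := distForm_le_QEC (corona G H) f hf
      have hsq : ∑ u, f u ^ 2 = (B ^ 2 + p * q * Q ^ 2) * ∑ i, g i ^ 2 := by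
        rw [Fintype.sum_prod_type, Finset.mul_sum]
        refine Finset.sum_congr rfl fun i _ => ?_
        simp [f, Fintype.sum_option]
        ring
      have hdefect : ∑ i, (∑ k, (∑ l, f (i, some (k, l))) ^ 2 + ∑ a, f (i, some a) ^ 2) =
          p * q * (q + 1) * Q ^ 2 * ∑ i, g i ^ 2 := by
        rw [Finset.mul_sum]
        refine Finset.sum_congr rfl fun i _ => ?_
        simp [f]
        ring
      rw [hform f hf, hsq, hdefect, ← hM] at h
      simp only [hfib, distForm_smul] at h
      rw [div_mul_eq_mul_div, le_div_iff₀ hT]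
      linarith
    rw [le_div_iff₀ hT] at hQle
    have hroot : L * (B ^ 2 + p * q * Q ^ 2) =
        Q * (B + p * q * Q) ^ 2 - p * q * (q + 1) * Q ^ 2 := by
      linear_combination B * hprod - p * q * Q ^ 2 * hBdef
    exact le_of_mul_le_mul_right (by linarith) hN

end QECPaper
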